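/- arXiv:1601.07304 — 2 statements merged into one kernel-verified Lean document; each statement's English description precedes it below -/
import Mathlib

section
/- Let M be a saturated countably infinite structure over a finite relational vocabulary, let ā ∈ M be a finite tuple, and let A = M↾ā. Then every embedding f: A → M may be extended into an automorphism of M if and only if tp(ā) is isolated by a quantifier-free formula. -/
open FirstOrder FirstOrder.Language CategoryTheory

namespace HomPaper

/-- The language consisting of `n` new relation symbols, the `i`-th of arity `k i`. -/
def expLang (n : ℕ) (k : Fin n → ℕ) : FirstOrder.Language.{0, 0} where
  Functions := fun _ => Empty
  Relations := fun m => {i : Fin n // k i = m}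

variable (L : FirstOrder.Language.{0, 0})

/-- The interpretation of the new relation symbols: the `i`-th symbol is interpreted
by the set defined by the formula `φ i`. -/
def expStructure (M : Type) [L.Structure M] {n : ℕ} {k : Fin n → ℕ}
    (φ : ∀ i : Fin n, L.Formula (Fin (k i))) : (expLang n k).Structure M where
  funMap := fun f _ => f.elim
  RelMap := fun {m} r x => (φ r.1).Realize (x ∘ Fin.cast r.2)

/-- `φ` is a family of homogenizing formulas for `M`: the expansion of `M` by new relation
symbols interpreted by the sets defined by the `φ i` is a homogeneous structure. -/
def Homogenizes (M : Type) [L.Structure M] {n : ℕ} {k : Fin n → ℕ}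
    (φ : ∀ i : Fin n, L.Formula (Fin (k i))) : Prop :=
  letI : (expLang n k).Structure M := expStructure L M φ
  (L.sum (expLang n k)).IsUltrahomogeneous M

/-- `M` is homogenizable. -/
def Homogenizable (M : Type) [L.Structure M] : Prop :=
  ∃ (n : ℕ) (k : Fin n → ℕ) (φ : ∀ i : Fin n, L.Formula (Fin (k i))),
    Homogenizes L M φ

/-- A `Σ₁`-formula: an existentially quantified quantifier-free formula. -/
def IsSigma1 {α : Type} (φ : L.Formula α) : Prop :=
  ∃ (m : ℕ) (ψ : L.BoundedFormula α m), ψ.IsQF ∧ φ = ψ.exs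

/-- `M` is `Σ₁`-homogenizable: homogenizable with `Σ₁` homogenizing formulas. -/
def Sigma1Homogenizable (M : Type) [L.Structure M] : Prop :=
  ∃ (n : ℕ) (k : Fin n → ℕ) (φ : ∀ i : Fin n, L.Formula (Fin (k i))),
    (∀ i, IsSigma1 L (φ i)) ∧ Homogenizes L M φ

/-- `M` is unary homogenizable: homogenizable with homogenizing formulas having
exactly one free variable. -/
def UnaryHomogenizable (M : Type) [L.Structure M] : Prop :=
  ∃ (n : ℕ) (φ : ∀ _ : Fin n, L.Formula (Fin 1)),
    Homogenizes L M (k := fun _ => 1) φ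

/-- Two tuples have the same complete type over `∅`. -/
def SameType (M : Type) [L.Structure M] {m : ℕ} (a b : Fin m → M) : Prop :=
  ∀ φ : L.Formula (Fin m), φ.Realize a ↔ φ.Realize b

/-- The complete type of the tuple `a` over `∅` is isolated by a quantifier-free formula. -/
def QFIsolated (M : Type) [L.Structure M] {m : ℕ} (a : Fin m → M) : Prop :=
  ∃ φ : L.Formula (Fin m), φ.IsQF ∧ φ.Realize a ∧
    ∀ b : Fin m → M, φ.Realize b → SameType L M a b

/-- `M` is boundedly homogenizable. -/
def BoundedlyHomogenizable (M : Type) [L.Structure M] : Prop :=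
  Homogenizable L M ∧
    ∀ (p : ℕ) (a : Fin p → M), ∃ (q : ℕ) (b : Fin q → M),
      QFIsolated L M (Fin.append a b)

/-- `M` is uniformly homogenizable. -/
def UniformlyHomogenizable (M : Type) [L.Structure M] : Prop :=
  Homogenizable L M ∧
    ∃ (p : ℕ) (a : Fin p → M), ∀ (q : ℕ) (b : Fin q → M),
      QFIsolated L M (Fin.append a b)

/-- `M` is `k`-unavoidably homogenizable: every complete `n`-type with `n ≥ k` is isolated by
a quantifier-free formula. -/
def KUnavoidablyHomogenizable (M : Type) [L.Structure M] (k : ℕ) : Prop :=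
  ∀ n : ℕ, k ≤ n → ∀ a : Fin n → M, QFIsolated L M a

/-- `M` is unavoidably homogenizable. -/
def UnavoidablyHomogenizable (M : Type) [L.Structure M] : Prop :=
  ∃ k : ℕ, KUnavoidablyHomogenizable L M k

/-- The age of `M`: the class of all finite structures embeddable into `M`
(i.e. all finite substructures of `M`, up to isomorphism). -/
def FinAge (M : Type) [L.Structure M] : Set (Bundled.{0} L.Structure) :=
  {N | Finite N ∧ Nonempty (N ↪[L] M)}

/-- The pair of embeddings `f`, `g` has an amalgam in the class `K`. -/
def HasAmalgam (K : Set (Bundled.{0} L.Structure)) {A B C : Type}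
    [L.Structure A] [L.Structure B] [L.Structure C]
    (f : A ↪[L] B) (g : A ↪[L] C) : Prop :=
  ∃ D ∈ K, ∃ (f0 : B ↪[L] D) (g0 : C ↪[L] D), ∀ x : A, f0 (f x) = g0 (g x)

/-- `A` is an amalgamation base for the class `K`. -/
def IsAmalgamationBase (K : Set (Bundled.{0} L.Structure)) (A : Type) [L.Structure A] : Prop :=
  ∀ B C : Bundled.{0} L.Structure, B ∈ K → C ∈ K →
    ∀ (f : A ↪[L] B) (g : A ↪[L] C), HasAmalgam L K f g

/-- The class `K` satisfies `SEAP_{k,m}`. -/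
def SEAPAt (K : Set (Bundled.{0} L.Structure)) (k m : ℕ) : Prop :=
  ∀ A B C : Bundled.{0} L.Structure, A ∈ K → B ∈ K → C ∈ K →
    ∀ (f : A ↪[L] B) (g : A ↪[L] C), ¬ HasAmalgam L K f g →
      ∃ A0 : L.Substructure A, Nat.card A0 < k ∧
      ∃ B0 ∈ K, ∃ C0 ∈ K, ∃ (eB : B ↪[L] B0) (eC : C ↪[L] C0),
        Nat.card B0 - Nat.card B < m ∧ Nat.card C0 - Nat.card C < m ∧
        ¬ HasAmalgam L K ((eB.comp f).comp A0.subtype) ((eC.comp g).comp A0.subtype)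

/-- The class `K` satisfies SEAP. -/
def SEAP (K : Set (Bundled.{0} L.Structure)) : Prop :=
  ∃ k m : ℕ, SEAPAt L K k m

/-- `M` is ω-categorical: `Th(M)` has exactly one countable model up to isomorphism. -/
def OmegaCategorical (M : Type) [L.Structure M] : Prop :=
  ∀ N₁ N₂ : ((L.completeTheory M).ModelType : Type 1),
    Countable N₁ → Countable N₂ → Nonempty (N₁ ≃[L] N₂)

/-- `M` is model-complete: every embedding between models of `Th(M)` is elementary. -/
def ModelComplete (M : Type) [L.Structure M] : Prop :=
  ∀ (N₁ N₂ : ((L.completeTheory M).ModelType : Type 1)) (f : N₁ ↪[L] N₂)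
    (p : ℕ) (φ : L.Formula (Fin p)) (x : Fin p → N₁),
    φ.Realize (fun i => f (x i)) ↔ φ.Realize x


/-- `M` is ω-saturated: every type over a finite tuple of parameters from `M` which is
consistent with `Th(M)` (equivalently, finitely realized in `M`) is realized in `M`. -/
def OmegaSaturated (M : Type) [L.Structure M] : Prop :=
  ∀ (p : ℕ) (c : Fin p → M) (S : Set (L.Formula (Fin (p + 1)))),
    (∀ s : Finset (L.Formula (Fin (p + 1))), ↑s ⊆ S →
      ∃ a : M, ∀ φ ∈ s, φ.Realize (Fin.snoc c a)) →
    ∃ a : M, ∀ φ ∈ S, φ.Realize (Fin.snoc c a)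

/-- `M` is ω-stable: over every countable parameter set there are at most countably many
complete types. -/
def OmegaStable (M : Type) [L.Structure M] : Prop :=
  ∀ A : Set M, A.Countable →
    ∀ p : ℕ, Countable ((L[[↥A]].completeTheory M).CompleteType (Fin p))

/-- The complete type of `a` is isolated by a conjunction of (relabelings of) the
homogenizing formulas `φ` and quantifier-free formulas. -/
def IsolatedByHomConj (M : Type) [L.Structure M] {n : ℕ} {k : Fin n → ℕ}
    (φ : ∀ i : Fin n, L.Formula (Fin (k i))) {p : ℕ} (a : Fin p → M) : Prop :=
  ∃ ψ : L.Formula (Fin p), ψ.IsQF ∧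
    ∃ ts : List (Σ i : Fin n, Fin (k i) → Fin p),
      (ψ.Realize a ∧ ∀ t ∈ ts, ((φ t.1).relabel t.2).Realize a) ∧
      ∀ b : Fin p → M,
        (ψ.Realize b ∧ ∀ t ∈ ts, ((φ t.1).relabel t.2).Realize b) → SameType L M a b

/-- `a` and `b` realize the same type over the parameter set `X`. -/
def EqTypeOver (M : Type) [L.Structure M] (X : Set M) (a b : M) : Prop :=
  ∀ (p : ℕ) (c : Fin p → M), Set.range c ⊆ X →
    ∀ φ : L.Formula (Fin (p + 1)), φ.Realize (Fin.snoc c a) ↔ φ.Realize (Fin.snoc c b)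

/-- The algebraic closure in `M` is degenerate: `acl(X) = X` for every `X ⊆ M`. -/
def DegenerateAcl (M : Type) [L.Structure M] : Prop :=
  ∀ (X : Set M) (a : M), {b : M | EqTypeOver L M X a b}.Finite → a ∈ X

/-- The induced structure on a subset of a structure for a relational language. -/
def inducedStructure (M : Type) [L.Structure M] [L.IsRelational] (A : Set M) :
    L.Structure A where
  funMap := fun f _ => isEmptyElim f
  RelMap := fun r x => Structure.RelMap r fun i => (x i : M)

/-- Elements `a` and `b` satisfy the same atomic formulas in one free variable
(the same atomic diagram). -/
def SameAtomic1 (M : Type) [L.Structure M] (a b : M) : Prop :=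
  ∀ φ : L.Formula (Fin 1), φ.IsAtomic →
    (φ.Realize (fun _ => a) ↔ φ.Realize (fun _ => b))

/-- `M` has uniformly homogenizing formulas. -/
def HasUniformlyHomogenizingFormulas (M : Type) [L.Structure M] : Prop :=
  ∃ (n : ℕ) (k m : Fin n → ℕ)
    (ψ : ∀ i : Fin n, L.BoundedFormula (Fin (k i)) (m i)),
    (∀ i, (ψ i).IsQF) ∧ Homogenizes L M (fun i => (ψ i).exs) ∧
    ∀ i, ∃ w : Fin (m i) → M, ∀ y : Fin (k i) → M,
      (∃ w0 : Fin (m i) → M, (ψ i).Realize y w0) → (ψ i).Realize y w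

end HomPaper

namespace HomPaper

section

variable {L : FirstOrder.Language.{0, 0}} {M N : Type} [L.Structure M] [L.Structure N]

/-- Embeddings preserve and reflect quantifier-free formulas. -/
theorem realize_embedding_of_isQF {α : Type} {n : ℕ} {φ : L.BoundedFormula α n} (hφ : φ.IsQF)
    (f : N ↪[L] M) (v : α → N) (xs : Fin n → N) :
    φ.Realize (f ∘ v) (f ∘ xs) ↔ φ.Realize v xs := by
  have hterm (t : L.Term (α ⊕ Fin n)) :
      t.realize (Sum.elim (f ∘ v) (f ∘ xs)) = f (t.realize (Sum.elim v xs)) := by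
    rw [← Sum.comp_elim, HomClass.realize_term]
  induction hφ with
  | falsum => exact Iff.rfl
  | of_isAtomic h =>
    cases h with
    | equal t₁ t₂ => simp [hterm]
    | rel R ts =>
      simp only [BoundedFormula.realize_rel, hterm]
      exact f.map_rel R _
  | imp _ _ h₁ h₂ => simp [h₁, h₂]

theorem isQF_iInf {α β : Type} [Finite β] {φ : β → L.Formula α} (h : ∀ b, (φ b).IsQF) :
    (Formula.iInf φ).IsQF := by
  have hfoldr (l : List β) : ((l.map φ).foldr (· ⊓ ·) ⊤).IsQF := by
    induction l with
    | nil => exact BoundedFormula.IsQF.top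
    | cons b l ih => exact (h b).inf ih
  exact hfoldr _

/-- With finitely many relation symbols, a single quantifier-free formula describes all equalities
and relations among the entries of `a`. -/
theorem exists_isQF_atomicDiagram [Finite (Σ n : ℕ, L.Relations n)] {p : ℕ} (a : Fin p → M) :
    ∃ φ : L.Formula (Fin p), φ.IsQF ∧ φ.Realize a ∧ ∀ b : Fin p → M, φ.Realize b →
      (∀ i j, a i = a j ↔ b i = b j) ∧
      ∀ (n : ℕ) (R : L.Relations n) (σ : Fin n → Fin p),
        Structure.RelMap R (a ∘ σ) ↔ Structure.RelMap R (b ∘ σ) := by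
  classical
  let signed (χ : L.Formula (Fin p)) : L.Formula (Fin p) := if χ.Realize a then χ else χ.not
  have signed_isQF (χ : L.Formula (Fin p)) (h : χ.IsQF) : (signed χ).IsQF := by
    dsimp only [signed]
    split_ifs
    exacts [h, h.not]
  have signed_realize (χ : L.Formula (Fin p)) (b : Fin p → M) :
      (signed χ).Realize b ↔ (χ.Realize a ↔ χ.Realize b) := by
    by_cases h : χ.Realize a <;> simp [signed, h]
  let eqs (ij : Fin p × Fin p) : L.Formula (Fin p) :=
    Term.equal (Term.var ij.1) (Term.var ij.2)
  let rels (r : Σ R : (Σ n : ℕ, L.Relations n), (Fin R.1 → Fin p)) : L.Formula (Fin p) :=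
    Relations.formula r.1.2 fun i => Term.var (r.2 i)
  refine ⟨Formula.iInf (fun ij => signed (eqs ij)) ⊓ Formula.iInf (fun r => signed (rels r)),
    ?_, ?_, ?_⟩
  · exact (isQF_iInf fun ij => signed_isQF _ (BoundedFormula.IsAtomic.equal _ _).isQF).inf
      (isQF_iInf fun r => signed_isQF _ (BoundedFormula.IsAtomic.rel _ _).isQF)
  · simp [signed_realize]
  · intro b hb
    rw [Formula.realize_inf, Formula.realize_iInf, Formula.realize_iInf] at hb
    refine ⟨fun i j => ?_, fun n R σ => ?_⟩
    · simpa [signed_realize, eqs] using hb.1 (i, j)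
    · simpa [signed_realize, rels, Formula.realize_rel, Function.comp_def] using hb.2 ⟨⟨n, R⟩, σ⟩

theorem SameType.symm {m : ℕ} {a b : Fin m → M} (h : SameType L M a b) : SameType L M b a :=
  fun φ => (h φ).symm

theorem SameType.comp {m n : ℕ} {a b : Fin m → M} (h : SameType L M a b) (σ : Fin n → Fin m) :
    SameType L M (a ∘ σ) (b ∘ σ) := fun φ => by
  simpa only [Formula.realize_relabel] using h (φ.relabel σ)

/-- Over an ω-saturated structure, tuples of the same type can be extended by one element. -/
theorem SameType.exists_snoc (hsat : OmegaSaturated L M) {n : ℕ} {c d : Fin n → M}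
    (h : SameType L M c d) (x : M) :
    ∃ y, SameType L M (Fin.snoc c x : Fin (n + 1) → M) (Fin.snoc d y : Fin (n + 1) → M) := by
  obtain ⟨y, hy⟩ := hsat n d {φ | φ.Realize (Fin.snoc c x : Fin (n + 1) → M)} <| by
    intro s hs
    let σ : Fin (n + 1) → Fin n ⊕ Unit := Fin.snoc (α := fun _ => Fin n ⊕ Unit) Sum.inl (Sum.inr ())
    have hσ (e : Fin n → M) (z : Unit → M) : Sum.elim e z ∘ σ = Fin.snoc e (z ()) := by
      ext i
      refine Fin.lastCases ?_ (fun j => ?_) i <;> simp [σ]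
    let ψ : L.Formula (Fin n) :=
      ((Formula.iInf fun φ : s => φ.1).relabel σ).iExs Unit
    have hψ (e : Fin n → M) : ψ.Realize e ↔
        ∃ z : Unit → M, ∀ φ ∈ s, φ.Realize (Fin.snoc e (z ()) : Fin (n + 1) → M) := by
      simp only [ψ, Formula.realize_iExs, Formula.realize_relabel, Formula.realize_iInf, hσ,
        Subtype.forall]
    obtain ⟨z, hz⟩ := (hψ d).1 ((h ψ).1 ((hψ c).2 ⟨fun _ => x, fun φ hφ => hs hφ⟩))
    exact ⟨z (), hz⟩
  refine ⟨y, fun φ => ⟨fun hφ => hy φ hφ, fun hφ => ?_⟩⟩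
  by_contra hn
  exact (Formula.realize_not.1 (hy φ.not (Formula.realize_not.2 hn))) hφ

/-- A relation on `M` such that corresponding tuples have the same type. -/
def IsPartialElementary (L : FirstOrder.Language.{0, 0}) {M : Type} [L.Structure M]
    (s : Set (M × M)) : Prop :=
  ∀ (n : ℕ) (c : Fin n → M × M), (∀ i, c i ∈ s) → SameType L M (Prod.fst ∘ c) (Prod.snd ∘ c)

theorem SameType.isPartialElementary_range {n : ℕ} {a b : Fin n → M} (h : SameType L M a b) :
    IsPartialElementary L (Set.range fun i => (a i, b i)) := by
  intro m c hc
  choose σ hσ using hc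
  obtain rfl : (fun j => (a (σ j), b (σ j))) = c := funext hσ
  exact h.comp σ

theorem IsPartialElementary.swap {s : Set (M × M)} (hs : IsPartialElementary L s) :
    IsPartialElementary L (Prod.swap '' s) := by
  intro n c hc
  refine (hs n (Prod.swap ∘ c) fun i => ?_).symm
  obtain ⟨x, hx, hxc⟩ := hc i
  simpa [← hxc] using hx

theorem IsPartialElementary.exists_insert (hsat : OmegaSaturated L M) {s : Set (M × M)}
    (hfin : s.Finite) (hs : IsPartialElementary L s) (x : M) :
    ∃ y, IsPartialElementary L (insert (x, y) s) := by
  obtain ⟨n, c, hc⟩ := hfin.fin_embedding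
  obtain ⟨y, hy⟩ := (hs n c fun i => hc ▸ Set.mem_range_self i).exists_snoc hsat x
  refine ⟨y, ?_⟩
  convert! hy.isPartialElementary_range using 1
  rw [← hc]
  ext z
  simp only [Set.mem_insert_iff, Set.mem_range, Fin.exists_fin_succ', Fin.snoc_castSucc,
    Fin.snoc_last, Function.comp_apply, Prod.mk.eta]
  tauto

theorem IsPartialElementary.fst_eq_iff {s : Set (M × M)} (hs : IsPartialElementary L s)
    {x y : M × M} (hx : x ∈ s) (hy : y ∈ s) : x.1 = y.1 ↔ x.2 = y.2 := by
  have h := hs 2 ![x, y] (by simp [Fin.forall_fin_two, hx, hy])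
    (Term.equal (Term.var 0) (Term.var 1))
  simpa using h

/-- A total and surjective partial elementary relation is the graph of an automorphism. -/
theorem IsPartialElementary.exists_equiv {s : Set (M × M)} (hs : IsPartialElementary L s)
    (hdom : ∀ x, ∃ y, (x, y) ∈ s) (hcod : ∀ y, ∃ x, (x, y) ∈ s) :
    ∃ g : M ≃[L] M, ∀ x y, (x, y) ∈ s → g x = y := by
  choose f hf using hdom
  choose f' hf' using hcod
  refine ⟨{ toFun := f
            invFun := f'
            left_inv := fun x => (hs.fst_eq_iff (hf' (f x)) (hf x)).2 rfl
            right_inv := fun y => (hs.fst_eq_iff (hf (f' y)) (hf' y)).1 rfl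
            map_fun' := fun {n} F v => ?_
            map_rel' := fun {n} R v => ?_ }, fun x y hxy => (hs.fst_eq_iff (hf x) hxy).1 rfl⟩
  · have hc : ∀ i, (Fin.snoc (fun i => (v i, f (v i)))
        (Structure.funMap F v, f (Structure.funMap F v)) : Fin (n + 1) → M × M) i ∈ s := by
      intro i
      refine Fin.lastCases ?_ (fun j => ?_) i <;> simp [hf]
    have h := hs (n + 1) _ hc (Term.equal (Term.var (Fin.last n))
      (Term.func F fun i => Term.var i.castSucc))
    simpa [Function.comp_def] using h
  · have h := hs n (fun i => (v i, f (v i))) (fun i => hf (v i))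
      (Relations.formula R fun i => Term.var i)
    simpa [Formula.realize_rel, Function.comp_def] using h.symm

/-- A finite partial elementary relation on a countable ω-saturated structure extends to an
automorphism. -/
theorem IsPartialElementary.exists_equiv_of_finite [Countable M] (hsat : OmegaSaturated L M)
    {s : Set (M × M)} (hfin : s.Finite) (hs : IsPartialElementary L s) :
    ∃ g : M ≃[L] M, ∀ x y, (x, y) ∈ s → g x = y := by
  let P := {t : Set (M × M) // t.Finite ∧ IsPartialElementary L t}
  let definedAt : M ⊕ M → Order.Cofinal P := Sum.elim
    (fun x =>
      { carrier := {t | ∃ y, (x, y) ∈ t.1}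
        isCofinal := fun t => by
          obtain ⟨y, hy⟩ := t.2.2.exists_insert hsat t.2.1 x
          exact ⟨⟨_, t.2.1.insert _, hy⟩, ⟨y, Set.mem_insert _ _⟩, Set.subset_insert _ _⟩ })
    (fun y =>
      { carrier := {t | ∃ x, (x, y) ∈ t.1}
        isCofinal := fun t => by
          obtain ⟨x, hx⟩ := t.2.2.swap.exists_insert hsat (t.2.1.image _) y
          have hx' := hx.swap
          rw [Set.image_insert_eq, ← Set.image_comp, Prod.swap_swap_eq, Set.image_id] at hx'
          exact ⟨⟨_, t.2.1.insert _, hx'⟩, ⟨x, Set.mem_insert _ _⟩, Set.subset_insert _ _⟩ })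
  have : Encodable (M ⊕ M) := Encodable.ofCountable _
  let I := Order.idealOfCofinals (⟨s, hfin, hs⟩ : P) definedAt
  have hmeets := Order.cofinal_meets_idealOfCofinals (⟨s, hfin, hs⟩ : P) definedAt
  let u : Set (M × M) := {z | ∃ t ∈ I, z ∈ t.1}
  have hu : IsPartialElementary L u := by
    intro n c hc
    choose t htI hct using hc
    obtain ⟨t', ht'I, ht'⟩ : ∃ t' ∈ I, ∀ i, t i ≤ t' := by
      have : Nonempty I := I.nonempty.to_subtype
      have : IsDirectedOrder I := I.directed.isDirectedOrder
      obtain ⟨t', ht'⟩ := (Set.finite_range fun i => (⟨t i, htI i⟩ : I)).bddAbove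
      exact ⟨t', t'.2, fun i => ht' ⟨i, rfl⟩⟩
    exact t'.2.2 n c fun i => ht' i (hct i)
  obtain ⟨g, hg⟩ := hu.exists_equiv
    (fun x => by
      obtain ⟨t, ⟨y, hy⟩, htI⟩ := hmeets (Sum.inl x)
      exact ⟨y, t, htI, hy⟩)
    (fun y => by
      obtain ⟨t, ⟨x, hx⟩, htI⟩ := hmeets (Sum.inr y)
      exact ⟨x, t, htI, hx⟩)
  exact ⟨g, fun x y hxy => hg x y ⟨_, Order.mem_idealOfCofinals _ _, hxy⟩⟩

/-- A tuple with the same atomic diagram as `a` is the image of `a` under an embedding. -/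
theorem exists_embedding_closure_range [L.IsRelational] {p : ℕ} {a b : Fin p → M}
    (heq : ∀ i j, a i = a j ↔ b i = b j)
    (hrel : ∀ (n : ℕ) (R : L.Relations n) (σ : Fin n → Fin p),
      Structure.RelMap R (a ∘ σ) ↔ Structure.RelMap R (b ∘ σ)) :
    ∃ f : Substructure.closure L (Set.range a) ↪[L] M,
      ∀ i, f ⟨a i, Substructure.subset_closure ⟨i, rfl⟩⟩ = b i := by
  have hidx (x : Substructure.closure L (Set.range a)) : ∃ i, a i = x :=
    (Substructure.mem_closure_iff_of_isRelational L (Set.range a) x).1 x.2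
  choose idx hidx using hidx
  refine ⟨{ toFun := fun x => b (idx x)
            inj' := fun x y hxy => Subtype.ext ?_
            map_fun' := fun F => isEmptyElim F
            map_rel' := fun {n} R v => ?_ }, fun i => ?_⟩
  · rw [← hidx x, ← hidx y]
    exact (heq _ _).2 hxy
  · refine (hrel n R (idx ∘ v)).symm.trans ?_
    rw [show a ∘ idx ∘ v = Subtype.val ∘ v from funext fun i => hidx (v i)]
    exact Iff.rfl
  · exact (heq _ _).1 (hidx _)

end

/-- In a saturated countably infinite structure, every embedding of `M↾ā` into
`M` extends to an automorphism iff `tp(ā)` is isolated by a quantifier-free formula. -/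
theorem extend_embedding_iff_qfIsolated
    (L : FirstOrder.Language.{0, 0}) [L.IsRelational] [Finite (Σ n : ℕ, L.Relations n)]
    (M : Type) [L.Structure M] [Countable M] [Infinite M]
    (hsat : OmegaSaturated L M) {p : ℕ} (a : Fin p → M) :
    (∀ f : ↥(Substructure.closure L (Set.range a)) ↪[L] M,
      ∃ g : M ≃[L] M, ∀ x : ↥(Substructure.closure L (Set.range a)), g x = f x) ↔
    QFIsolated L M a := by
  constructor
  · intro h
    obtain ⟨φ, hqf, hφa, hφ⟩ := exists_isQF_atomicDiagram (L := L) a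
    refine ⟨φ, hqf, hφa, fun b hb => ?_⟩
    obtain ⟨f, hf⟩ := exists_embedding_closure_range (hφ b hb).1 (hφ b hb).2
    obtain ⟨g, hg⟩ := h f
    obtain rfl : g ∘ a = b :=
      funext fun i => (hg ⟨a i, Substructure.subset_closure ⟨i, rfl⟩⟩).trans (hf i)
    exact fun ψ => (StrongHomClass.realize_formula g ψ).symm
  · rintro ⟨φ, hqf, hφa, hφ⟩ f
    let a' (i : Fin p) : Substructure.closure L (Set.range a) :=
      ⟨a i, Substructure.subset_closure ⟨i, rfl⟩⟩
    have hφ' : φ.Realize (f ∘ a') := by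
      have h₁ := realize_embedding_of_isQF hqf f a' default
      have h₂ := realize_embedding_of_isQF hqf (Substructure.subtype _) a' default
      rw [Subsingleton.elim (_ ∘ default) default] at h₁ h₂
      exact h₁.2 (h₂.1 hφa)
    obtain ⟨g, hg⟩ := (hφ _ hφ').isPartialElementary_range.exists_equiv_of_finite hsat
      (Set.finite_range _)
    refine ⟨g, fun x => ?_⟩
    obtain ⟨i, hi⟩ := (Substructure.mem_closure_iff_of_isRelational L _ _).1 x.2
    obtain rfl : a' i = x := Subtype.ext hi
    exact hg _ _ ⟨i, rfl⟩

end HomPaper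
end

section
/- Let N be a model-complete, ω-categorical, countably infinite structure over a finite relational vocabulary. If Age(N) satisfies SEAP, then N is homogenizable. -/
open FirstOrder FirstOrder.Language CategoryTheory

namespace HomPaper

variable {L : FirstOrder.Language.{0, 0}}

/-- Two tuples indexed by an arbitrary type satisfy the same formulas. -/
def TypeEq {α M M' : Type} [L.Structure M] [L.Structure M'] (a : α → M) (b : α → M') : Prop :=
  ∀ φ : L.Formula α, φ.Realize a ↔ φ.Realize b

/-- The complete type of a tuple is isolated by a single formula. -/
def Isolated {α M : Type} [L.Structure M] (a : α → M) : Prop :=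
  ∃ θ : L.Formula α, θ.Realize a ∧ ∀ b : α → M, θ.Realize b → TypeEq (L := L) a b

section TypeEq

variable {α β M M' M'' : Type} [L.Structure M] [L.Structure M'] [L.Structure M'']

theorem TypeEq.symm {a : α → M} {b : α → M'} (h : TypeEq (L := L) a b) : TypeEq (L := L) b a :=
  fun φ => (h φ).symm

theorem TypeEq.trans {a : α → M} {b : α → M'} {c : α → M''} (h : TypeEq (L := L) a b)
    (h' : TypeEq (L := L) b c) : TypeEq (L := L) a c :=
  fun φ => (h φ).trans (h' φ)

theorem TypeEq.comp {a : α → M} {b : α → M'} (h : TypeEq (L := L) a b) (t : β → α) :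
    TypeEq (L := L) (a ∘ t) (b ∘ t) := fun φ => by
  simpa only [Formula.realize_relabel] using h (φ.relabel t)

theorem typeEq_of_fin [Finite α] {a : α → M} {b : α → M'}
    (h : ∀ t : Fin (Nat.card α) → α, TypeEq (L := L) (a ∘ t) (b ∘ t)) : TypeEq (L := L) a b := by
  have := (h (Finite.equivFin α).symm).comp (Finite.equivFin α)
  rwa [Function.comp_assoc, Function.comp_assoc, Equiv.symm_comp_self] at this

theorem TypeEq.eq_iff {a : α → M} {b : α → M'} (h : TypeEq (L := L) a b) (i j : α) :
    a i = a j ↔ b i = b j := by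
  simpa [Formula.realize_equal] using h ((Term.var i).equal (Term.var j))

theorem TypeEq.relMap_iff {a : α → M} {b : α → M'} (h : TypeEq (L := L) a b) {n : ℕ}
    (r : L.Relations n) (t : Fin n → α) :
    Structure.RelMap r (a ∘ t) ↔ Structure.RelMap r (b ∘ t) := by
  simpa [Formula.realize_rel, Function.comp_def] using h (r.formula fun i => Term.var (t i))

theorem TypeEq.of_equiv (e : M ≃[L] M') (a : α → M) : TypeEq (L := L) a (e ∘ a) :=
  fun φ => (StrongHomClass.realize_formula e φ).symm

/-- An extension of an isolated type transfers between tuples of the same type. -/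
theorem TypeEq.exists_extend [Finite β] {a b : α → M} (h : TypeEq (L := L) a b) (c : β → M)
    (hc : Isolated (L := L) (Sum.elim a c)) :
    ∃ d : β → M, TypeEq (L := L) (Sum.elim a c) (Sum.elim b d) := by
  obtain ⟨θ, hθ, hiso⟩ := hc
  have hb : (θ.iExs β).Realize b := (h _).1 (Formula.realize_iExs.2 ⟨c, hθ⟩)
  obtain ⟨d, hd⟩ := Formula.realize_iExs.1 hb
  exact ⟨d, hiso _ hd⟩

theorem Isolated.of_typeEq {a b : α → M} (h : TypeEq (L := L) a b) (ha : Isolated (L := L) a) :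
    Isolated (L := L) b := by
  obtain ⟨θ, hθ, hiso⟩ := ha
  exact ⟨θ, (h θ).1 hθ, fun c hc => h.symm.trans (hiso c hc)⟩

/-- A reindexing of an isolated tuple is isolated. -/
theorem Isolated.comp [Finite α] [Finite β] {a : α → M} (ha : Isolated (L := L) a) (t : β → α) :
    Isolated (L := L) (a ∘ t) := by
  obtain ⟨θ, hθ, hiso⟩ := ha
  refine ⟨Formula.iExs α (θ.relabel Sum.inr ⊓
    Formula.iInf fun j : β => (Term.var (Sum.inl j)).equal (Term.var (Sum.inr (t j)))), ?_, ?_⟩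
  · simp only [Formula.realize_iExs, Formula.realize_inf, Formula.realize_relabel,
      Formula.realize_iInf, Formula.realize_equal, Term.realize_var]
    exact ⟨a, hθ, fun j => rfl⟩
  · intro b hb
    simp only [Formula.realize_iExs, Formula.realize_inf, Formula.realize_relabel,
      Formula.realize_iInf, Formula.realize_equal, Term.realize_var] at hb
    obtain ⟨c, hc, hcb⟩ := hb
    have hb : b = c ∘ t := funext hcb
    rw [hb]
    exact (hiso c hc).comp t

/-- A tuple with the same type as an embedding is an embedding. -/
theorem TypeEq.exists_embedding [L.IsRelational] {a : α → M} {b : α → M'}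
    (h : TypeEq (L := L) a b) [L.Structure α] (i : α ↪[L] M) (hi : ⇑i = a) :
    ∃ j : α ↪[L] M', ⇑j = b := by
  subst hi
  refine ⟨⟨⟨b, fun x y hxy => i.injective ((h.eq_iff x y).2 hxy)⟩, fun f => isEmptyElim f,
    fun r x => ?_⟩, rfl⟩
  exact (h.relMap_iff r x).symm.trans (i.map_rel r x)

end TypeEq

section Categorical

variable {N : Type} [L.Structure N] [Infinite N]

theorem model_ultrapower {ι : Type} (u : Ultrafilter ι) :
    (u : Filter ι).Product (fun _ => N) ⊨ L.completeTheory N :=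
  ⟨fun φ hφ => (Ultraproduct.sentence_realize φ).2 (Filter.Eventually.of_forall fun _ => hφ)⟩

/-- Embeddings of a model-complete structure into models of its theory preserve formulas. -/
theorem ModelComplete.realize_iff (hmc : ModelComplete L N) {P : Type} [L.Structure P]
    [Nonempty P] [P ⊨ L.completeTheory N] (F : N ↪[L] P) {α : Type} [Finite α]
    (φ : L.Formula α) (a : α → N) : φ.Realize (F ∘ a) ↔ φ.Realize a := by
  obtain ⟨p, ⟨σ⟩⟩ := Finite.exists_equiv_fin α
  have h : (φ.relabel σ).Realize (fun i => F (a (σ.symm i))) ↔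
      (φ.relabel σ).Realize (fun i => a (σ.symm i)) :=
    hmc (Theory.ModelType.of _ N) (Theory.ModelType.of _ P) F p (φ.relabel σ) _
  simpa only [Formula.realize_relabel, Function.comp_def, Equiv.symm_apply_apply] using h

variable [Countable N]

/-- A countable model of the theory of an ω-categorical structure is isomorphic to it. -/
theorem OmegaCategorical.exists_equiv (hcat : OmegaCategorical L N) (M : Type) [L.Structure M]
    [Countable M] [Nonempty M] (hM : M ⊨ L.completeTheory N) : Nonempty (M ≃[L] N) :=
  hcat (Theory.ModelType.of _ M) (Theory.ModelType.of _ N)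
    (inferInstanceAs (Countable M)) (inferInstanceAs (Countable N))

variable [L.IsRelational] [Finite (Σ n : ℕ, L.Relations n)]

/-- A finitely satisfiable set of formulas is realized in an ω-categorical structure. -/
theorem OmegaCategorical.exists_realize (hcat : OmegaCategorical L N) {α : Type} [Countable α]
    (S : Set (L.Formula α))
    (hS : ∀ s : Finset (L.Formula α), ↑s ⊆ S → ∃ a : α → N, ∀ φ ∈ s, φ.Realize a) :
    ∃ a : α → N, ∀ φ ∈ S, φ.Realize a := by
  classical
  have hS' : ∀ s : Finset S, ∃ a : α → N, ∀ φ ∈ s, (φ : L.Formula α).Realize a := fun s => by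
    obtain ⟨a, ha⟩ := hS (s.image Subtype.val) (by simp)
    exact ⟨a, fun φ hφ => ha φ (Finset.mem_image_of_mem _ hφ)⟩
  choose a ha using hS'
  let u : Ultrafilter (Finset S) := Ultrafilter.of Filter.atTop
  let P := (u : Filter (Finset S)).Product (fun _ => N)
  have hP : P ⊨ L.completeTheory N := model_ultrapower u
  let b : α → P := fun i => ((fun s => a s i : Finset S → N) : P)
  have hb : ∀ φ ∈ S, φ.Realize b := fun φ hφ => by
    refine (Ultraproduct.realize_formula_cast (M := fun _ => N) (u := u) φ fun i s => a s i).2 ?_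
    refine Ultrafilter.of_le Filter.atTop ?_
    filter_upwards [Filter.eventually_ge_atTop {⟨φ, hφ⟩}] with s hs
    exact ha s ⟨φ, hφ⟩ (hs (Finset.mem_singleton_self _))
  have hinf : Infinite P := (elementarilyEquivalent_iff.2 fun φ =>
    (L.realize_iff_of_model_completeTheory N P φ).symm).infinite_iff.1 ‹_›
  obtain ⟨E, hE, hcard⟩ := exists_elementarySubstructure_card_eq L (Set.range b)
    Cardinal.aleph0.{0} le_rfl (Cardinal.lift_le.2 (Cardinal.mk_le_aleph0_iff.2 (Set.countable_range b).to_subtype))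
    (Cardinal.lift_le.2 (Cardinal.mk_le_aleph0 (α := L.Symbols))) (by simp)
  have hEc : Countable E := Cardinal.mk_le_aleph0_iff.1 (by simpa using hcard.le)
  have hEne : Nonempty E := inferInstance
  obtain ⟨e⟩ := hcat.exists_equiv E inferInstance
  refine ⟨fun i => e ⟨b i, hE ⟨i, rfl⟩⟩, fun φ hφ => ?_⟩
  refine (TypeEq.of_equiv e (fun i => (⟨b i, hE ⟨i, rfl⟩⟩ : E)) φ).1 ?_
  exact (E.subtype.map_formula φ _).1 (hb φ hφ)

/-- Isolated types are dense in an ω-categorical structure. -/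
theorem OmegaCategorical.exists_isolated_realize (hcat : OmegaCategorical L N) {α : Type}
    [Finite α] (φ : L.Formula α) (a : α → N) (hφ : φ.Realize a) :
    ∃ b : α → N, φ.Realize b ∧ Isolated (L := L) b := by
  by_contra! hno
  let P := {ψ : L.Formula α // (∃ c : α → N, ψ.Realize c) ∧
    ∀ c : α → N, ψ.Realize c → φ.Realize c}
  have hstep : ∀ (c : α → N) (ψ : P), ∃ χ : P, (∀ d : α → N, χ.1.Realize d → ψ.1.Realize d) ∧
      ¬ χ.1.Realize c := by
    rintro c ⟨ψ, ⟨d, hd⟩, hψ⟩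
    by_cases hc : ψ.Realize c
    · have hni : ¬ Isolated (L := L) c := hno c (hψ c hc)
      have : ∃ e : α → N, ψ.Realize e ∧ ¬ TypeEq (L := L) c e := by
        by_contra! h
        exact hni ⟨ψ, hc, h⟩
      obtain ⟨e, he, hne⟩ := this
      have : ∃ χ : L.Formula α, χ.Realize e ∧ ¬ χ.Realize c := by
        by_contra! h
        refine hne fun χ => ⟨fun h1 => ?_, h χ⟩
        by_contra h2
        exact h χ.not (by simpa using h2) h1
      obtain ⟨χ, h1, h2⟩ := this
      exact ⟨⟨ψ ⊓ χ, ⟨e, by simp [he, h1]⟩, fun d hd => hψ d (Formula.realize_inf.1 hd).1⟩,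
        fun d hd => (Formula.realize_inf.1 hd).1, by simp [h2]⟩
    · exact ⟨⟨ψ, ⟨d, hd⟩, hψ⟩, fun d hd => hd, hc⟩
  choose F hF hFn using hstep
  obtain ⟨e, he⟩ := exists_surjective_nat (α → N)
  let s : ℕ → P := fun n => n.rec ⟨φ, ⟨a, hφ⟩, fun _ h => h⟩ fun k ψ => F (e k) ψ
  have hanti : ∀ m n, m ≤ n → ∀ d : α → N, (s n).1.Realize d → (s m).1.Realize d := by
    intro m n hmn
    induction hmn with
    | refl => exact fun d h => h
    | step _ ih => exact fun d h => ih d (hF _ _ d h)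
  obtain ⟨b, hb⟩ := hcat.exists_realize (Set.range fun n => (s n).1) (by
    intro t ht
    have : ∃ n, ∀ χ ∈ t, ∃ m ≤ n, (s m).1 = χ := by
      classical
      induction t using Finset.induction_on with
      | empty => exact ⟨0, by simp⟩
      | insert χ t _ ih =>
        rw [Finset.coe_insert, Set.insert_subset_iff] at ht
        obtain ⟨n, hn⟩ := ih ht.2
        obtain ⟨m, hm⟩ := ht.1
        refine ⟨max m n, fun χ' hχ' => ?_⟩
        rcases Finset.mem_insert.1 hχ' with rfl | h
        · exact ⟨m, le_max_left _ _, hm⟩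
        · obtain ⟨k, hk, hk'⟩ := hn χ' h
          exact ⟨k, hk.trans (le_max_right _ _), hk'⟩
    obtain ⟨n, hn⟩ := this
    obtain ⟨c, hc⟩ := (s n).2.1
    refine ⟨c, fun χ hχ => ?_⟩
    obtain ⟨m, hm, rfl⟩ := hn χ hχ
    exact hanti m n hm c hc)
  obtain ⟨k, rfl⟩ := he b
  exact hFn (e k) (s k) (hb _ ⟨k + 1, rfl⟩)

/-- A formula satisfiable over an isolated tuple has a witness for which the extended tuple
is isolated. -/
theorem OmegaCategorical.exists_isolated_extend (hcat : OmegaCategorical L N) {α β : Type}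
    [Finite α] [Finite β] {a : α → N} (ha : Isolated (L := L) a) (φ : L.Formula (α ⊕ β))
    (c : β → N) (hφ : φ.Realize (Sum.elim a c)) :
    ∃ d : β → N, φ.Realize (Sum.elim a d) ∧ Isolated (L := L) (Sum.elim a d) := by
  obtain ⟨θ, hθ, hiso⟩ := ha
  obtain ⟨e, he, hei⟩ := hcat.exists_isolated_realize (θ.relabel Sum.inl ⊓ φ) (Sum.elim a c)
    (by simp [Formula.realize_relabel, hθ, hφ])
  simp only [Formula.realize_inf, Formula.realize_relabel] at he
  have hsplit : Sum.elim (e ∘ Sum.inl) (e ∘ Sum.inr) = e := Sum.elim_comp_inl_inr e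
  obtain ⟨d, hd⟩ := (hiso _ he.1).symm.exists_extend (e ∘ Sum.inr) (hsplit.symm ▸ hei)
  rw [hsplit] at hd
  exact ⟨d, (hd φ).1 he.2, hei.of_typeEq hd⟩

/-- An ω-categorical structure has an elementary substructure all of whose finite subsets
have isolated types. -/
theorem OmegaCategorical.exists_atomic_elementarySubstructure (hcat : OmegaCategorical L N) :
    ∃ E : L.ElementarySubstructure N, ∀ (n : ℕ) (a : Fin n → N), (∀ i, a i ∈ E) →
      Isolated (L := L) a := by
  classical
  let P := {s : Finset N // Isolated (L := L) (Subtype.val : s → N)}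
  let ι := Σ n : ℕ, L.BoundedFormula Empty (n + 1) × (Fin n → N)
  have : ∀ n, Countable (L.BoundedFormula Empty (n + 1)) := fun n =>
    (sigma_mk_injective (β := fun n => L.BoundedFormula Empty n) (i := n + 1)).countable
  have : Countable ι := inferInstance
  have : Encodable ι := Encodable.ofCountable ι
  let good (i : ι) (b : N) : Prop := i.2.1.Realize default (Fin.snoc i.2.2 b : _ → N)
  let 𝒟 : ι → Order.Cofinal P := fun i =>
    { carrier := {s | (∃ b, good i b) → (∀ t ≥ s, ¬ ∀ j, i.2.2 j ∈ t.1) ∨ ∃ b ∈ s.1, good i b}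
      isCofinal := by
        intro s
        by_cases hs : ∀ t ≥ s, ¬ ∀ j, i.2.2 j ∈ t.1
        · exact ⟨s, fun _ => Or.inl hs, le_rfl⟩
        by_cases hb : ∃ b, good i b
        swap
        · exact ⟨s, fun h => absurd h hb, le_rfl⟩
        push Not at hs
        obtain ⟨t, hst, ht⟩ := hs
        obtain ⟨b, hb⟩ := hb
        let ρ : Fin (i.1 + 1) → t.1 ⊕ Unit := Fin.snoc (fun j => Sum.inl ⟨i.2.2 j, ht j⟩)
          (Sum.inr ())
        have hρ : ∀ c : N, Sum.elim (Subtype.val : t.1 → N) (fun _ => c) ∘ ρ =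
            Fin.snoc i.2.2 c := fun c => by
          funext j
          refine Fin.lastCases ?_ (fun j => ?_) j <;> simp [ρ]
        let φ : L.Formula (t.1 ⊕ Unit) := (i.2.1.toFormula).relabel (Sum.elim Empty.elim ρ)
        have hφ : ∀ c : N, φ.Realize (Sum.elim (Subtype.val : t.1 → N) fun _ => c) ↔
            good i c := fun c => by
          simp only [φ, good, Formula.realize_relabel, BoundedFormula.realize_toFormula, ← hρ]
          rw [Subsingleton.elim (default : Empty → N)]
          rfl
        obtain ⟨d, hd, hdi⟩ := hcat.exists_isolated_extend t.2 φ (fun _ => b) ((hφ b).2 hb)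
        have hsurj : ∀ x : (insert (d ()) t.1 : Finset N), ∃ y : t.1 ⊕ Unit,
            Sum.elim (Subtype.val : t.1 → N) d y = x := by
          rintro ⟨x, hx⟩
          rcases Finset.mem_insert.1 hx with rfl | hx
          · exact ⟨Sum.inr (), rfl⟩
          · exact ⟨Sum.inl ⟨x, hx⟩, rfl⟩
        choose τ hτ using hsurj
        refine ⟨⟨insert (d ()) t.1, ?_⟩, fun _ => Or.inr ⟨d (), Finset.mem_insert_self _ _, ?_⟩,
          hst.trans (Finset.subset_insert _ _)⟩
        · have := hdi.comp τ
          rwa [show Sum.elim (Subtype.val : t.1 → N) d ∘ τ = Subtype.val from funext hτ] at this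
        · exact (hφ _).1 hd }
  have hP : Nonempty P := by
    obtain ⟨b, -, hb⟩ := hcat.exists_isolated_realize (α := (∅ : Finset N)) ⊤ Subtype.val (by simp)
    exact ⟨⟨∅, by rwa [Subsingleton.elim b Subtype.val] at hb⟩⟩
  obtain ⟨p⟩ := hP
  let I := Order.idealOfCofinals p 𝒟
  let X : L.Substructure N := ⟨{x | ∃ s ∈ I, x ∈ s.1}, fun f => isEmptyElim f⟩
  have hdir : ∀ (n : ℕ) (a : Fin n → N), (∀ i, a i ∈ X) → ∃ s ∈ I, ∀ i, a i ∈ s.1 := by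
    intro n a ha
    induction n with
    | zero => exact ⟨p, Order.mem_idealOfCofinals p 𝒟, fun i => i.elim0⟩
    | succ n ih =>
      obtain ⟨s, hs, hs'⟩ := ih (fun i => a i.castSucc) fun i => ha _
      obtain ⟨t, ht, ht'⟩ := ha (Fin.last n)
      obtain ⟨r, hr, hsr, htr⟩ := I.directed s hs t ht
      exact ⟨r, hr, Fin.lastCases (htr ht') fun i => hsr (hs' i)⟩
  refine ⟨X.toElementarySubstructure ?_, fun n a ha => ?_⟩
  · intro n φ x b hb
    let i : ι := ⟨n, φ, (↑) ∘ x⟩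
    obtain ⟨s, hs, hsI⟩ := Order.cofinal_meets_idealOfCofinals p 𝒟 i
    rcases hs ⟨b, hb⟩ with h | ⟨c, hc, hc'⟩
    · obtain ⟨t, ht, ht'⟩ := hdir n (Subtype.val ∘ x) fun j => (x j).2
      obtain ⟨r, hr, hsr, htr⟩ := I.directed s hsI t ht
      exact absurd (fun j => htr (ht' j)) (h r hsr)
    · exact ⟨⟨c, s, hsI, hc⟩, hc'⟩
  · obtain ⟨s, -, hs⟩ := hdir n a ha
    exact s.2.comp fun j => ⟨a j, hs j⟩

/-- Every finite tuple of an ω-categorical structure has an isolated type. -/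
theorem OmegaCategorical.isolated (hcat : OmegaCategorical L N) {α : Type} [Finite α]
    (a : α → N) : Isolated (L := L) a := by
  obtain ⟨n, ⟨σ⟩⟩ := Finite.exists_equiv_fin α
  obtain ⟨E, hE⟩ := hcat.exists_atomic_elementarySubstructure
  have : Nonempty E := inferInstance
  have hEc : Countable E := Subtype.val_injective.countable
  obtain ⟨e⟩ := hcat.exists_equiv E inferInstance
  have hval : ∀ {β : Type} (x : β → E), TypeEq (L := L) x ((↑) ∘ x : β → N) :=
    fun x φ => (E.subtype.map_formula φ x).symm
  obtain ⟨θ, hθ, hiso⟩ := (hE n ((↑) ∘ e.symm ∘ a ∘ σ.symm) fun i => Subtype.property _).comp σ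
  have hto : ∀ b : α → N, TypeEq (L := L) b ((↑) ∘ e.symm ∘ b : α → N) := fun b =>
    (TypeEq.of_equiv e.symm b).trans (hval _)
  have hσ : ((↑) ∘ e.symm ∘ a ∘ σ.symm : Fin n → N) ∘ σ = (↑) ∘ e.symm ∘ a := by
    funext i; simp
  rw [hσ] at hθ hiso
  exact ⟨θ, (hto a θ).2 hθ, fun b hb =>
    (hto a).trans ((hiso _ ((hto b θ).1 hb)).trans (hto b).symm)⟩

/-- In an ω-categorical structure finitely many formulas determine the types of `n`-tuples. -/
theorem OmegaCategorical.exists_finset_formula (hcat : OmegaCategorical L N) (n : ℕ) :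
    ∃ s : Finset (L.Formula (Fin n)), ∀ a b : Fin n → N,
      (∀ φ ∈ s, φ.Realize a → φ.Realize b) → TypeEq (L := L) a b := by
  classical
  choose θ hθ hiso using fun a : Fin n → N => hcat.isolated (L := L) a
  have hcover : ∃ t : Finset (L.Formula (Fin n)), ↑t ⊆ Set.range (fun a => (θ a).not) ∧
      ∀ a : Fin n → N, ∃ φ ∈ t, ¬ φ.Realize a := by
    by_contra! hno
    obtain ⟨b, hb⟩ := hcat.exists_realize (Set.range fun a => (θ a).not) hno
    exact hb _ ⟨b, rfl⟩ (hθ b)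
  obtain ⟨t, ht, hcover⟩ := hcover
  choose c hc using fun φ : t => ht φ.2
  refine ⟨Finset.univ.image fun φ : t => θ (c φ), fun a b hab => ?_⟩
  obtain ⟨φ, hφ, hna⟩ := hcover a
  have ha : (θ (c ⟨φ, hφ⟩)).Realize a := by
    have := hc ⟨φ, hφ⟩
    simp only at this
    rwa [← this, Formula.realize_not, not_not] at hna
  have hb := hab _ (Finset.mem_image_of_mem _ (Finset.mem_univ ⟨φ, hφ⟩)) ha
  exact (hiso _ a ha).symm.trans (hiso _ b hb)

/-- In a model-complete ω-categorical structure, the type of a finite tuple is witnessed by a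
finite substructure: every embedding of the substructure preserves the type of the tuple. -/
theorem ModelComplete.exists_finite_witness (hmc : ModelComplete L N)
    (hcat : OmegaCategorical L N) {α : Type} [Finite α] (a : α → N) :
    ∃ B : L.Substructure N, Finite B ∧ ∃ h : ∀ i, a i ∈ B, ∀ e : B ↪[L] N,
      TypeEq (L := L) a (fun i => e ⟨a i, h i⟩) := by
  classical
  by_contra! hno
  obtain ⟨θ, hθ, hiso⟩ := hcat.isolated (L := L) a
  have hfun : ∀ s : Finset N, ∃ g : N → N, ¬ θ.Realize (g ∘ a) ∧
      (∀ x ∈ s, ∀ y ∈ s, g x = g y → x = y) ∧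
      ∀ (n : ℕ) (r : L.Relations n) (x : Fin n → N), (∀ i, x i ∈ s) →
        (Structure.RelMap r (g ∘ x) ↔ Structure.RelMap r x) := by
    intro s
    let B : L.Substructure N := Substructure.closure L (↑s ∪ Set.range a)
    have hBmem : ∀ x, x ∈ B ↔ x ∈ s ∨ x ∈ Set.range a := fun x => by simp [B]
    have hBfin : Finite B := by
      have : ((↑s ∪ Set.range a : Set N)).Finite := s.finite_toSet.union (Set.finite_range a)
      refine (this.subset fun x hx => ?_).to_subtype
      exact (hBmem x).1 hx
    obtain ⟨e, he⟩ := hno B hBfin fun i => (hBmem _).2 (Or.inr ⟨i, rfl⟩)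
    have hs : ∀ x ∈ s, x ∈ B := fun x hx => (hBmem x).2 (Or.inl hx)
    have ha : ∀ i, a i ∈ B := fun i => (hBmem _).2 (Or.inr ⟨i, rfl⟩)
    let g : N → N := fun x => if hx : x ∈ B then e ⟨x, hx⟩ else x
    have hg : ∀ x (hx : x ∈ B), g x = e ⟨x, hx⟩ := fun x hx => by simp [g, hx]
    refine ⟨g, fun hr => he ?_, fun x hx y hy hxy => ?_, fun n r x hx => ?_⟩
    · have : (fun i => e ⟨a i, ha i⟩) = g ∘ a := funext fun i => (hg _ _).symm
      rw [this]
      exact hiso _ hr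
    · rw [hg x (hs x hx), hg y (hs y hy)] at hxy
      exact congrArg Subtype.val (e.injective hxy)
    · have : g ∘ x = e ∘ fun i => (⟨x i, hs _ (hx i)⟩ : B) := funext fun i => hg _ _
      rw [this]
      exact e.map_rel r _
  choose g hgθ hgi hgr using hfun
  let u : Ultrafilter (Finset N) := Ultrafilter.of Filter.atTop
  let P := (u : Filter (Finset N)).Product (fun _ => N)
  have hP : P ⊨ L.completeTheory N := model_ultrapower u
  have hmem : ∀ t : Finset N, ∀ᶠ s in (u : Filter (Finset N)), t ⊆ s := fun t =>
    Ultrafilter.of_le Filter.atTop (Filter.eventually_ge_atTop t)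
  have hcast : ∀ {β : Type} (φ : L.Formula β) (x : β → N),
      (φ.Realize fun i => ((fun s => g s (x i) : Finset N → N) : P)) ↔
        ∀ᶠ s in (u : Filter (Finset N)), φ.Realize (g s ∘ x) := fun φ x =>
    Ultraproduct.realize_formula_cast (M := fun _ => N) (u := u) φ fun i s => g s (x i)
  let F : N ↪[L] P :=
    { toFun := fun x => ((fun s => g s x : Finset N → N) : P)
      inj' := fun x y hxy => by
        have h : ∀ᶠ s in (u : Filter (Finset N)), g s x = g s y := Quotient.exact' hxy
        obtain ⟨s, hs, hs'⟩ := (h.and (hmem {x, y})).exists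
        exact hgi s x (hs' (by simp)) y (hs' (by simp)) hs
      map_fun' := fun f => isEmptyElim f
      map_rel' := fun {n} r x => by
        have h := hcast (r.formula fun i => Term.var i) x
        simp only [Formula.realize_rel, Term.realize_var] at h
        refine h.trans ?_
        have hx : ∀ᶠ s in (u : Filter (Finset N)),
            (Structure.RelMap r (g s ∘ x) ↔ Structure.RelMap r x) := by
          filter_upwards [hmem (Finset.univ.image x)] with s hs
          exact hgr s n r x fun i => hs (Finset.mem_image_of_mem _ (Finset.mem_univ i))
        exact (Filter.eventually_congr hx).trans (by simp) }
  have hFθ := (hmc.realize_iff F θ a).2 hθ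
  obtain ⟨s, hs⟩ := ((hcast θ a).1 hFθ).exists
  exact hgθ s hs

/-- Under `SEAP_{k,m}`, an embedding which preserves the types of tuples of length less than `k`
preserves all types. -/
theorem ModelComplete.typeEq_of_seapAt (hmc : ModelComplete L N) (hcat : OmegaCategorical L N)
    {k m : ℕ} (hseap : SEAPAt L (FinAge L N) k m) {A : Type} [L.Structure A] [Finite A]
    (i f : A ↪[L] N)
    (h : ∀ n < k, ∀ t : Fin n → A, TypeEq (L := L) (i ∘ t) (f ∘ t)) :
    TypeEq (L := L) i f := by
  obtain ⟨B, hBf, hB, hBt⟩ := hmc.exists_finite_witness hcat i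
  obtain ⟨C, hCf, hC, hCt⟩ := hmc.exists_finite_witness hcat f
  by_cases ham : HasAmalgam L (FinAge L N) (i.codRestrict B hB) (f.codRestrict C hC)
  · obtain ⟨D, ⟨-, ⟨d⟩⟩, f0, g0, hfg⟩ := ham
    have hb := hBt (d.comp f0)
    have hc := hCt (d.comp g0)
    refine hb.trans ?_
    convert hc.symm using 1
    exact funext fun x => congrArg d (hfg x)
  · obtain ⟨A0, hA0, B0, ⟨hB0, ⟨b⟩⟩, C0, ⟨hC0, ⟨c⟩⟩, eB, eC, -, -, hno⟩ :=
      hseap (Bundled.of A) (Bundled.of B) (Bundled.of C) ⟨‹_›, ⟨i⟩⟩ ⟨hBf, ⟨B.subtype⟩⟩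
        ⟨hCf, ⟨C.subtype⟩⟩ _ _ ham
    refine absurd ?_ hno
    have hb := (hBt (b.comp eB)).comp (Subtype.val : A0 → A)
    have hc := (hCt (c.comp eC)).comp (Subtype.val : A0 → A)
    have : Finite A0 := inferInstanceAs (Finite {x : A // x ∈ A0})
    have hA : TypeEq (L := L) (i ∘ (Subtype.val : A0 → A)) (f ∘ (Subtype.val : A0 → A)) :=
      typeEq_of_fin fun t => h _ hA0 (Subtype.val ∘ t)
    obtain ⟨d, hd⟩ := (hb.symm.trans (hA.trans hc)).exists_extend b (hcat.isolated _)
    obtain ⟨j, hj⟩ := (hd.comp Sum.inr).exists_embedding b rfl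
    let D : L.Substructure N := Substructure.closure L (Set.range j ∪ Set.range c)
    have hDfin : Finite D := by
      refine (((Set.finite_range j).union (Set.finite_range c)).subset fun x hx => ?_).to_subtype
      exact (Substructure.mem_closure_iff_of_isRelational L _ x).1 hx
    refine ⟨Bundled.of D, ⟨hDfin, ⟨D.subtype⟩⟩,
      j.codRestrict D fun x => Substructure.subset_closure (Or.inl ⟨x, rfl⟩),
      c.codRestrict D fun x => Substructure.subset_closure (Or.inr ⟨x, rfl⟩), fun x => ?_⟩
    refine Subtype.ext ?_
    have := (hd.eq_iff (Sum.inr (eB ⟨i x.1, hB x.1⟩)) (Sum.inl x)).1 rfl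
    simp only [Sum.elim_inr, Sum.elim_inl] at this
    exact (congrFun hj _).trans this

end Categorical

instance (n : ℕ) (k : Fin n → ℕ) : (expLang n k).IsRelational :=
  fun _ => inferInstanceAs (IsEmpty Empty)

/-- A model-complete, ω-categorical, countably infinite structure whose age
satisfies SEAP is homogenizable. -/
theorem seap_homogenizable
    (L : FirstOrder.Language.{0, 0}) [L.IsRelational] [Finite (Σ n : ℕ, L.Relations n)]
    (N : Type) [L.Structure N] [Countable N] [Infinite N]
    (hmc : ModelComplete L N) (hcat : OmegaCategorical L N)
    (hseap : SEAP L (FinAge L N)) :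
    Homogenizable L N := by
  classical
  obtain ⟨k, m, hseap⟩ := hseap
  choose s hs using fun n => hcat.exists_finset_formula (L := L) n
  let Φ : Finset (Σ n : ℕ, L.Formula (Fin n)) := (Finset.range k).sigma s
  let ar : Fin Φ.card → ℕ := fun i => (Φ.equivFin.symm i).1.1
  let φ : ∀ i, L.Formula (Fin (ar i)) := fun i : Fin Φ.card => (Φ.equivFin.symm i).1.2
  refine ⟨Φ.card, ar, φ, ?_⟩
  let _ : (expLang Φ.card ar).Structure N := expStructure L N φ
  change (L.sum (expLang Φ.card ar)).IsUltrahomogeneous N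
  rw [isUltrahomogeneous_iff_IsExtensionPair Structure.cg_of_countable,
    isExtensionPair_iff_exists_embedding_closure_singleton_sup]
  intro S hS f c
  have hSfin : Finite S := hS.finite
  have htype : TypeEq (L := L) (Subtype.val : S → N) f := by
    let _ : L.Structure S := (LHom.sumInl : L →ᴸ L.sum (expLang Φ.card ar)).reduct S
    let i : S ↪[L] N := ⟨⟨Subtype.val, Subtype.val_injective⟩, fun g => isEmptyElim g,
      fun _ _ => Iff.rfl⟩
    let j : S ↪[L] N := ⟨⟨f, f.injective⟩, fun g => isEmptyElim g,
      fun r x => f.map_rel (Sum.inl r) x⟩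
    refine hmc.typeEq_of_seapAt hcat hseap i j fun n hn t => hs n _ _ fun ψ hψ hr => ?_
    let p : Φ := ⟨⟨n, ψ⟩, Finset.mem_sigma.2 ⟨Finset.mem_range.2 hn, hψ⟩⟩
    have hp : Φ.equivFin.symm (Φ.equivFin p) = p := Equiv.symm_apply_apply _ _
    let r : (expLang Φ.card ar).Relations n :=
      ⟨Φ.equivFin p, congrArg (fun q : Φ => q.1.1) hp⟩
    have hrel : ∀ x : Fin n → N, Structure.RelMap r x ↔ ψ.Realize x := by
      have : ∀ (q : Φ) (_ : q = p) (hq : q.1.1 = n) (x : Fin n → N),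
          q.1.2.Realize (x ∘ Fin.cast hq) ↔ ψ.Realize x := by
        rintro q rfl hq x
        rfl
      exact this _ hp _
    exact (hrel _).1 ((f.map_rel (Sum.inr r) t).2 ((hrel _).2 hr))
  obtain ⟨d, hd⟩ := htype.exists_extend (fun _ : Unit => c) (hcat.isolated _)
  let T : (L.sum (expLang Φ.card ar)).Substructure N :=
    Substructure.closure _ {c} ⊔ S
  have hT : ∀ x : T, ∃ y : S ⊕ Unit, Sum.elim Subtype.val (fun _ : Unit => c) y = (x : N) := by
    rintro ⟨x, hx⟩
    have hTc : T = Substructure.closure _ ({c} ∪ (S : Set N)) := by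
      rw [Substructure.closure_union, Substructure.closure_eq]
    rw [hTc, Substructure.mem_closure_iff_of_isRelational] at hx
    rcases hx with rfl | hx
    · exact ⟨Sum.inr (), rfl⟩
    · exact ⟨Sum.inl ⟨x, hx⟩, rfl⟩
  choose τ hτ using hT
  have hval := hd.comp τ
  rw [show Sum.elim Subtype.val (fun _ : Unit => c) ∘ τ = Subtype.val from funext hτ] at hval
  let g : T ↪[L.sum (expLang Φ.card ar)] N :=
    { toFun := Sum.elim f d ∘ τ
      inj' := fun x y hxy => Subtype.ext ((hval.eq_iff x y).2 hxy)
      map_fun' := fun f => isEmptyElim f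
      map_rel' := fun r x => by
        rcases r with r | r
        · exact (hval.relMap_iff r x).symm
        · exact ((hval.comp (x ∘ Fin.cast r.2)) (φ r.1)).symm }
  refine ⟨g, Embedding.ext fun x => ?_⟩
  have hx := hτ (Substructure.inclusion le_sup_right x)
  exact (hd.eq_iff (Sum.inl x) _).1 hx.symm

end HomPaper
end
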